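/- Let N, D, d be positive integers and M, M_θ ≥ 0. Let Q, K, V ∈ ℝ^{D×d} each have Frobenius norm at most M_θ. Define the single-head dot-product self-attention f(X) = softmax(X Q (X K)^⊤ / √d) · X V for X ∈ ℝ^{N×D}, with softmax applied row-wise. Then f is Lipschitz on the set {X ∈ ℝ^{N×D} : ‖X‖_F ≤ M} with respect to the Frobenius norm, with Lipschitz constant at most M_θ · ( (M_θ² / √d) · M² · (√N + 1) + √N ). -/

import Mathlib

open scoped Matrix

/-- Frobenius norm of a real matrix. -/
noncomputable def frobNorm {m n : Type*} [Fintype m] [Fintype n] (X : Matrix m n ℝ) : ℝ :=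
  Real.sqrt (∑ i, ∑ j, (X i j) ^ 2)

/-- Spectral norm (operator norm induced by Euclidean norms) of a real matrix. -/
noncomputable def specNorm {m n : ℕ} (A : Matrix (Fin m) (Fin n) ℝ) : ℝ :=
  ‖(Matrix.toEuclideanLin A).toContinuousLinearMap‖

/-- Euclidean norm of a vector in ℝ^n. -/
noncomputable def evNorm {n : ℕ} (v : Fin n → ℝ) : ℝ := Real.sqrt (∑ i, (v i) ^ 2)

/-- Row-wise softmax of a square matrix. -/
noncomputable def softmax {N : ℕ} (M : Matrix (Fin N) (Fin N) ℝ) : Matrix (Fin N) (Fin N) ℝ :=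
  Matrix.of fun i j => Real.exp (M i j) / ∑ k, Real.exp (M i k)

/-- Horizontal concatenation `[f 0, f 1, …, f (R-1)]` of `R` matrices of size `m × n`
into a single `m × (R·n)` matrix (block `r` occupies columns `r·n, …, r·n + n - 1`). -/
def hConcat {m n R : ℕ} (f : Fin R → Matrix (Fin m) (Fin n) ℝ) :
    Matrix (Fin m) (Fin (R * n)) ℝ :=
  Matrix.of fun i j => f j.divNat i j.modNat

/-- Vertical stacking of `R` matrices of size `m × n` into a single `(R·m) × n` matrix
(block `r` occupies rows `r·m, …, r·m + m - 1`). -/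
def vConcat {m n R : ℕ} (f : Fin R → Matrix (Fin m) (Fin n) ℝ) :
    Matrix (Fin (R * m)) (Fin n) ℝ :=
  Matrix.of fun i j => f i.divNat i.modNat j

attribute [local instance] Matrix.frobeniusNormedAddCommGroup Matrix.frobeniusNormedSpace

theorem frobNorm_eq_norm {m n : Type*} [Fintype m] [Fintype n] (X : Matrix m n ℝ) :
    frobNorm X = ‖X‖ := by
  simp [frobNorm, Matrix.frobenius_norm_def, Real.sqrt_eq_rpow]

/-- The softmax of a vector indexed by a finite type. -/
noncomputable def vecSoftmax {ι : Type*} [Fintype ι] (a : ι → ℝ) (i : ι) : ℝ :=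
  Real.exp (a i) / ∑ k, Real.exp (a k)

section VecSoftmax

variable {ι : Type*} [Fintype ι]

theorem vecSoftmax_nonneg (a : ι → ℝ) (i : ι) : 0 ≤ vecSoftmax a i := by
  unfold vecSoftmax
  positivity

theorem sum_exp_pos [Nonempty ι] (a : ι → ℝ) : 0 < ∑ k, Real.exp (a k) :=
  Finset.sum_pos (fun _ _ => Real.exp_pos _) Finset.univ_nonempty

theorem sum_vecSoftmax [Nonempty ι] (a : ι → ℝ) : ∑ i, vecSoftmax a i = 1 := by
  simp only [vecSoftmax, ← Finset.sum_div]
  exact div_self (sum_exp_pos a).ne'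

theorem vecSoftmax_le_one [Nonempty ι] (a : ι → ℝ) (i : ι) : vecSoftmax a i ≤ 1 :=
  sum_vecSoftmax a ▸
    Finset.single_le_sum (fun j _ => vecSoftmax_nonneg a j) (Finset.mem_univ i)

theorem hasDerivAt_vecSoftmax_line [Nonempty ι] (b h : ι → ℝ) (i : ι) (t : ℝ) :
    HasDerivAt (fun s => vecSoftmax (fun k => b k + s * h k) i)
      (vecSoftmax (fun k => b k + t * h k) i *
        (h i - ∑ k, vecSoftmax (fun k => b k + t * h k) k * h k)) t := by
  have hexp : ∀ k, HasDerivAt (fun s : ℝ => Real.exp (b k + s * h k))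
      (Real.exp (b k + t * h k) * h k) t := fun k => by
    simpa using (((hasDerivAt_id t).mul_const (h k)).const_add (b k)).exp
  have hpos := sum_exp_pos fun k => b k + t * h k
  have hsum : HasDerivAt (fun s : ℝ => ∑ k, Real.exp (b k + s * h k))
      (∑ k, Real.exp (b k + t * h k) * h k) t := HasDerivAt.fun_sum fun k _ => hexp k
  refine ((hexp i).fun_div hsum hpos.ne').congr_deriv ?_
  simp only [vecSoftmax, div_mul_eq_mul_div, ← Finset.sum_div]
  field_simp

/-- A weighted covariance is bounded by the product of the Euclidean norms. -/
theorem sq_sum_mul_centered_le (p u h : ι → ℝ) (hp : ∀ i, 0 ≤ p i) (hp1 : ∀ i, p i ≤ 1)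
    (hsum : ∑ i, p i = 1) :
    (∑ i, u i * (p i * (h i - ∑ k, p k * h k))) ^ 2 ≤ (∑ i, u i ^ 2) * ∑ i, h i ^ 2 := by
  set c := ∑ k, p k * h k with hc
  refine (Finset.sum_mul_sq_le_sq_mul_sq _ _ _).trans ?_
  refine mul_le_mul_of_nonneg_left ?_ (Finset.sum_nonneg fun i _ => sq_nonneg _)
  calc ∑ i, (p i * (h i - c)) ^ 2 ≤ ∑ i, p i * (h i - c) ^ 2 :=
        Finset.sum_le_sum fun i _ => by
          rw [mul_pow]
          exact mul_le_mul_of_nonneg_right (by nlinarith [hp i, hp1 i]) (sq_nonneg _)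
    _ = ∑ i, p i * h i ^ 2 - c ^ 2 := by
        have : ∀ i, p i * (h i - c) ^ 2 = p i * h i ^ 2 - 2 * c * (p i * h i) + c ^ 2 * p i :=
          fun i => by ring
        simp only [this, Finset.sum_add_distrib, Finset.sum_sub_distrib, ← Finset.mul_sum, hsum,
          ← hc]
        ring
    _ ≤ ∑ i, p i * h i ^ 2 := sub_le_self _ (sq_nonneg c)
    _ ≤ ∑ i, h i ^ 2 :=
        Finset.sum_le_sum fun i _ => mul_le_of_le_one_left (sq_nonneg _) (hp1 i)

/-- The softmax is nonexpansive for the Euclidean norm. -/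
theorem sum_sq_vecSoftmax_sub_le [Nonempty ι] (a b : ι → ℝ) :
    ∑ i, (vecSoftmax a i - vecSoftmax b i) ^ 2 ≤ ∑ i, (a i - b i) ^ 2 := by
  set u := fun i => vecSoftmax a i - vecSoftmax b i with hu
  set h := fun i => a i - b i with hh
  have hderiv : ∀ t : ℝ, HasDerivAt
      (fun s => ∑ i, u i * vecSoftmax (fun k => b k + s * h k) i)
      (∑ i, u i * (vecSoftmax (fun k => b k + t * h k) i *
        (h i - ∑ k, vecSoftmax (fun k => b k + t * h k) k * h k))) t := fun t =>
    HasDerivAt.fun_sum fun i _ => (hasDerivAt_vecSoftmax_line b h i t).const_mul (u i)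
  obtain ⟨t, -, ht⟩ := exists_hasDerivAt_eq_slope _ _ zero_lt_one
    (fun t _ => (hderiv t).continuousAt.continuousWithinAt) (fun t _ => hderiv t)
  have hle := sq_sum_mul_centered_le (vecSoftmax fun k => b k + t * h k) u h
    (vecSoftmax_nonneg _) (vecSoftmax_le_one _) (sum_vecSoftmax _)
  have hslope : ∑ i, u i * vecSoftmax a i - ∑ i, u i * vecSoftmax b i = ∑ i, u i ^ 2 := by
    rw [← Finset.sum_sub_distrib]
    exact Finset.sum_congr rfl fun i _ => by simp only [hu]; ring
  have hab : (fun k => b k + 1 * h k) = a := by ext k; simp [hh]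
  rw [ht, hab] at hle
  simp only [zero_mul, add_zero, sub_zero, div_one] at hle
  rw [hslope, sq] at hle
  change ∑ i, u i ^ 2 ≤ ∑ i, h i ^ 2
  have hu0 : 0 ≤ ∑ i, u i ^ 2 := Finset.sum_nonneg fun i _ => sq_nonneg _
  have hh0 : 0 ≤ ∑ i, h i ^ 2 := Finset.sum_nonneg fun i _ => sq_nonneg _
  rcases hu0.eq_or_lt with h0 | h0
  · exact h0 ▸ hh0
  · exact le_of_mul_le_mul_left hle h0

end VecSoftmax

theorem norm_softmax_sub_le {N : ℕ} (A B : Matrix (Fin N) (Fin N) ℝ) :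
    ‖softmax A - softmax B‖ ≤ ‖A - B‖ := by
  rw [← frobNorm_eq_norm, ← frobNorm_eq_norm]
  refine Real.sqrt_le_sqrt (Finset.sum_le_sum fun i _ => ?_)
  have : Nonempty (Fin N) := ⟨i⟩
  exact sum_sq_vecSoftmax_sub_le (A i) (B i)

theorem norm_softmax_le {N : ℕ} (A : Matrix (Fin N) (Fin N) ℝ) : ‖softmax A‖ ≤ √N := by
  rw [← frobNorm_eq_norm]
  refine Real.sqrt_le_sqrt ?_
  calc ∑ i, ∑ j, softmax A i j ^ 2 ≤ ∑ _i : Fin N, (1 : ℝ) :=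
        Finset.sum_le_sum fun i _ => by
          have : Nonempty (Fin N) := ⟨i⟩
          rw [← sum_vecSoftmax (A i)]
          exact Finset.sum_le_sum fun j _ =>
            pow_le_of_le_one (vecSoftmax_nonneg (A i) j) (vecSoftmax_le_one (A i) j) two_ne_zero
    _ = N := by simp

/-- The bilinear score map is Lipschitz on Frobenius balls. -/
theorem norm_mul_mul_transpose_sub_le {m n k : Type*} [Fintype m] [Fintype n] [Fintype k]
    {M Mθ : ℝ} {Q K : Matrix n k ℝ} (hQ : ‖Q‖ ≤ Mθ) (hK : ‖K‖ ≤ Mθ)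
    {X Y : Matrix m n ℝ} (hX : ‖X‖ ≤ M) (hY : ‖Y‖ ≤ M) :
    ‖X * Q * (X * K)ᵀ - Y * Q * (Y * K)ᵀ‖ ≤ 2 * (M * Mθ ^ 2 * ‖X - Y‖) := by
  have hM : 0 ≤ M := (norm_nonneg _).trans hX
  have hMθ : 0 ≤ Mθ := (norm_nonneg _).trans hQ
  have bound : ∀ Z W : Matrix m n ℝ, ‖Z * Q * (W * K)ᵀ‖ ≤ ‖Z‖ * Mθ * (‖W‖ * Mθ) := fun Z W =>
    calc ‖Z * Q * (W * K)ᵀ‖ ≤ ‖Z * Q‖ * ‖(W * K)ᵀ‖ := Matrix.frobenius_norm_mul _ _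
      _ ≤ (‖Z‖ * ‖Q‖) * (‖W‖ * ‖K‖) := by
          rw [Matrix.frobenius_norm_transpose]
          gcongr <;> exact Matrix.frobenius_norm_mul _ _
      _ ≤ ‖Z‖ * Mθ * (‖W‖ * Mθ) := by gcongr
  have split : X * Q * (X * K)ᵀ - Y * Q * (Y * K)ᵀ =
      (X - Y) * Q * (X * K)ᵀ + Y * Q * ((X - Y) * K)ᵀ := by
    simp only [Matrix.sub_mul, Matrix.mul_sub, Matrix.transpose_sub]
    abel
  calc ‖X * Q * (X * K)ᵀ - Y * Q * (Y * K)ᵀ‖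
      ≤ ‖X - Y‖ * Mθ * (‖X‖ * Mθ) + ‖Y‖ * Mθ * (‖X - Y‖ * Mθ) := by
        rw [split]
        exact (norm_add_le _ _).trans (add_le_add (bound _ _) (bound _ _))
    _ ≤ ‖X - Y‖ * Mθ * (M * Mθ) + M * Mθ * (‖X - Y‖ * Mθ) := by gcongr
    _ = 2 * (M * Mθ ^ 2 * ‖X - Y‖) := by ring

/-- Single-head dot-product self-attention with parameter matrices of
Frobenius norm at most `Mθ` is Lipschitz on the Frobenius ball of radius `M`, with
Lipschitz constant at most `Mθ · ((Mθ²/√d) · M² · (√N + 1) + √N)`. -/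
theorem singlehead_selfattention_locally_lipschitz
    (N D d : ℕ) (hN : 0 < N) (hD : 0 < D) (hd : 0 < d)
    (M Mθ : ℝ) (hM : 0 ≤ M) (hMθ : 0 ≤ Mθ)
    (Q K V : Matrix (Fin D) (Fin d) ℝ)
    (hQ : frobNorm Q ≤ Mθ) (hK : frobNorm K ≤ Mθ) (hV : frobNorm V ≤ Mθ)
    (f : Matrix (Fin N) (Fin D) ℝ → Matrix (Fin N) (Fin d) ℝ)
    (hf : ∀ X, f X = softmax ((Real.sqrt d)⁻¹ • (X * Q * (X * K)ᵀ)) * (X * V)) :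
    ∀ X Y : Matrix (Fin N) (Fin D) ℝ, frobNorm X ≤ M → frobNorm Y ≤ M →
      frobNorm (f X - f Y) ≤
        (Mθ * (Mθ ^ 2 / Real.sqrt d * M ^ 2 * (Real.sqrt N + 1) + Real.sqrt N)) *
          frobNorm (X - Y) := by
  intro X Y hX hY
  simp only [frobNorm_eq_norm, hf] at *
  set c := (√(d : ℝ))⁻¹ with hc
  have hc0 : 0 ≤ c := by positivity
  set S := fun Z : Matrix (Fin N) (Fin D) ℝ => softmax (c • (Z * Q * (Z * K)ᵀ))
  have hone : 1 ≤ √(N : ℝ) := Real.one_le_sqrt.2 (by exact_mod_cast hN)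
  have hsub : ‖S X - S Y‖ ≤ c * (2 * (M * Mθ ^ 2 * ‖X - Y‖)) := by
    refine (norm_softmax_sub_le _ _).trans ?_
    rw [← smul_sub, norm_smul, Real.norm_of_nonneg hc0]
    exact mul_le_mul_of_nonneg_left (norm_mul_mul_transpose_sub_le hQ hK hX hY) hc0
  have split : S X * (X * V) - S Y * (Y * V) = S X * ((X - Y) * V) + (S X - S Y) * (Y * V) := by
    simp only [Matrix.sub_mul, Matrix.mul_sub]
    abel
  change ‖S X * (X * V) - S Y * (Y * V)‖ ≤ _
  have bound : ∀ (A : Matrix (Fin N) (Fin N) ℝ) (Z : Matrix (Fin N) (Fin D) ℝ),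
      ‖A * (Z * V)‖ ≤ ‖A‖ * (‖Z‖ * Mθ) := fun A Z =>
    (Matrix.frobenius_norm_mul _ _).trans <| mul_le_mul_of_nonneg_left
      ((Matrix.frobenius_norm_mul _ _).trans (by gcongr)) (norm_nonneg _)
  calc ‖S X * (X * V) - S Y * (Y * V)‖
      ≤ ‖S X‖ * (‖X - Y‖ * Mθ) + ‖S X - S Y‖ * (‖Y‖ * Mθ) := by
        rw [split]
        exact (norm_add_le _ _).trans (add_le_add (bound _ _) (bound _ _))
    _ ≤ √N * (‖X - Y‖ * Mθ) + c * (2 * (M * Mθ ^ 2 * ‖X - Y‖)) * (M * Mθ) := by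
        gcongr
        exact norm_softmax_le _
    _ = Mθ * (Mθ ^ 2 * c * M ^ 2 * (1 + 1) + √N) * ‖X - Y‖ := by ring
    _ ≤ Mθ * (Mθ ^ 2 / √d * M ^ 2 * (√N + 1) + √N) * ‖X - Y‖ := by
        rw [div_eq_mul_inv, ← hc]
        gcongr
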